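/- Let d ≥ 1, 1 < p < ∞, δ ∈ ℝ, let m be an integer with m > 1 + d/p, and let K ≥ 1, ε > 0. Let φ = Id + u : ℝ^d → ℝ^d be a bijective C^m map with C^m inverse such that |u(x)| ≤ K for all x, |D^α u(x)| ≤ K⟨x⟩^{1−|α|} for all x ∈ ℝ^d and all multi-indices α with 1 ≤ |α| ≤ m, and det Dφ(x) ≥ ε for all x. Then there exists a constant C = C(d,m,p,δ,K,ε) such that for every f ∈ C_c^∞(ℝ^d) and every integer 0 ≤ k ≤ m, ‖f∘φ‖_{W^{k,p}_δ} ≤ C · ‖f‖_{W^{k,p}_δ}. -/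

import Mathlib

open MeasureTheory Filter
open scoped BigOperators ENNReal Topology

noncomputable section

/-- The Japanese bracket `⟨x⟩ = (1+|x|²)^{1/2}`. -/
def jb {d : ℕ} (x : EuclideanSpace ℝ (Fin d)) : ℝ := Real.sqrt (1 + ‖x‖ ^ 2)

/-- The partial derivative in the `i`-th coordinate direction. -/
def pd {d : ℕ} {F : Type*} [NormedAddCommGroup F] [NormedSpace ℝ F] (i : Fin d)
    (f : EuclideanSpace ℝ (Fin d) → F) : EuclideanSpace ℝ (Fin d) → F :=
  fun x => fderiv ℝ f x (EuclideanSpace.single i 1)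

/-- Iterated partial derivatives along a list of coordinate directions. -/
def pdList {d : ℕ} {F : Type*} [NormedAddCommGroup F] [NormedSpace ℝ F] :
    List (Fin d) → (EuclideanSpace ℝ (Fin d) → F) → EuclideanSpace ℝ (Fin d) → F
  | [], f => f
  | i :: l, f => pd i (pdList l f)

/-- The partial derivative `D^α f` corresponding to a multi-index `α : Fin d → ℕ`. -/
def mD {d : ℕ} {F : Type*} [NormedAddCommGroup F] [NormedSpace ℝ F] (α : Fin d → ℕ)
    (f : EuclideanSpace ℝ (Fin d) → F) : EuclideanSpace ℝ (Fin d) → F :=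
  pdList ((List.finRange d).flatMap fun i => List.replicate (α i) i) f

/-- The order `|α|` of a multi-index. -/
def msize {d : ℕ} (α : Fin d → ℕ) : ℕ := ∑ i, α i

/-- The finset of all multi-indices on `ℝ^d` of order at most `m`. -/
def mIdx (d m : ℕ) : Finset (Fin d → ℕ) :=
  (Fintype.piFinset fun _ : Fin d => Finset.range (m + 1)).filter fun α => msize α ≤ m

section partialDerivatives

variable {d : ℕ} {F : Type*} [NormedAddCommGroup F] [NormedSpace ℝ F]

theorem contDiff_pd {f : EuclideanSpace ℝ (Fin d) → F} {n : ℕ} (hf : ContDiff ℝ (n + 1 : ℕ) f)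
    (i : Fin d) : ContDiff ℝ n (pd i f) :=
  (hf.fderiv_right (m := n) (by norm_cast)).clm_apply contDiff_const

theorem contDiff_pdList (l : List (Fin d)) {f : EuclideanSpace ℝ (Fin d) → F} {n : ℕ}
    (hf : ContDiff ℝ (n + l.length : ℕ) f) : ContDiff ℝ n (pdList l f) := by
  induction l generalizing n with
  | nil => exact hf
  | cons i l ih =>
    refine contDiff_pd (ih (hf.of_le ?_)) i
    simp only [List.length_cons]
    exact_mod_cast (by omega : n + 1 + l.length ≤ n + (l.length + 1))

theorem pd_comm {f : EuclideanSpace ℝ (Fin d) → F} (hf : ContDiff ℝ 2 f) (i j : Fin d) :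
    pd i (pd j f) = pd j (pd i f) := by
  have hd : Differentiable ℝ (fderiv ℝ f) :=
    (hf.fderiv_right (m := 1) (by norm_num)).differentiable (by simp)
  have key : ∀ (i j : Fin d) (x : EuclideanSpace ℝ (Fin d)), pd i (pd j f) x =
      fderiv ℝ (fderiv ℝ f) x (EuclideanSpace.single i 1) (EuclideanSpace.single j 1) := by
    intro i j x
    change fderiv ℝ (fun y => fderiv ℝ f y (EuclideanSpace.single j 1)) x _ = _
    rw [fderiv_clm_apply (hd x) (differentiableAt_const _)]
    simp
  ext x
  rw [key, key]
  exact (hf.contDiffAt.isSymmSndFDerivAt (by simp)).eq _ _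

theorem pdList_perm {l l' : List (Fin d)} (h : l.Perm l') {f : EuclideanSpace ℝ (Fin d) → F}
    (hf : ContDiff ℝ l.length f) : pdList l f = pdList l' f := by
  induction h with
  | nil => rfl
  | cons i _ ih =>
    simp only [pdList]
    rw [ih (hf.of_le (by simp only [List.length_cons]; exact_mod_cast Nat.le_succ _))]
  | swap i j l =>
    refine pd_comm (contDiff_pdList (n := 2) l (hf.of_le ?_)) _ _
    simp only [List.length_cons]
    exact_mod_cast (by omega : 2 + l.length ≤ l.length + 1 + 1)
  | trans h₁ _ ih₁ ih₂ => rw [ih₁ hf, ih₂ (h₁.length_eq ▸ hf)]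

theorem pdList_ofFn {n : ℕ} (s : Fin n → Fin d) {f : EuclideanSpace ℝ (Fin d) → F}
    (hf : ContDiff ℝ n f) (x : EuclideanSpace ℝ (Fin d)) :
    pdList (List.ofFn s) f x =
      iteratedFDeriv ℝ n f x (fun j => EuclideanSpace.single (s j) 1) := by
  induction n generalizing x with
  | zero => simp [pdList]
  | succ n ih =>
    rw [List.ofFn_succ, iteratedFDeriv_succ_apply_left]
    have hd : DifferentiableAt ℝ (iteratedFDeriv ℝ n f) x :=
      hf.differentiable_iteratedFDeriv (by exact_mod_cast Nat.lt_succ_self n) x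
    have hfun : pdList (List.ofFn fun i => s i.succ) f =
        fun y => iteratedFDeriv ℝ n f y (fun j => EuclideanSpace.single (s j.succ) 1) :=
      funext fun y => ih _ (hf.of_le (by exact_mod_cast Nat.le_succ n)) y
    simp only [pdList, pd]
    rw [hfun]
    have := ((ContinuousMultilinearMap.apply ℝ (fun _ : Fin n => EuclideanSpace ℝ (Fin d)) F
      (fun j => EuclideanSpace.single (s j.succ) 1)).hasFDerivAt.comp x hd.hasFDerivAt).fderiv
    change fderiv ℝ (fun y => iteratedFDeriv ℝ n f y _) x = _ at this
    rw [this]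
    rfl

theorem norm_pdList_le (l : List (Fin d)) {f : EuclideanSpace ℝ (Fin d) → F}
    (hf : ContDiff ℝ l.length f) (x : EuclideanSpace ℝ (Fin d)) :
    ‖pdList l f x‖ ≤ ‖iteratedFDeriv ℝ l.length f x‖ := by
  have h := pdList_ofFn l.get hf x
  rw [List.ofFn_get] at h
  rw [h]
  refine (ContinuousMultilinearMap.le_opNorm _ _).trans ?_
  simp

theorem norm_le_sum_norm_apply_single {n : ℕ}
    (A : ContinuousMultilinearMap ℝ (fun _ : Fin n => EuclideanSpace ℝ (Fin d)) F) :
    ‖A‖ ≤ ∑ s : Fin n → Fin d, ‖A fun j => EuclideanSpace.single (s j) 1‖ := by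
  refine A.opNorm_le_bound (by positivity) fun v => ?_
  have hv : v = fun j => ∑ k, v j k • EuclideanSpace.single k (1 : ℝ) := by
    ext j i
    simp [Pi.single_apply]
  conv_lhs => rw [hv, A.map_sum]
  refine (norm_sum_le _ _).trans ?_
  rw [Finset.sum_mul]
  refine Finset.sum_le_sum fun s _ => ?_
  rw [A.map_smul_univ, norm_smul, norm_prod, mul_comm]
  gcongr with j
  exact PiLp.norm_apply_le (v j) (s j)

end partialDerivatives

section multiIndices

variable {d : ℕ} {F : Type*} [NormedAddCommGroup F] [NormedSpace ℝ F]

theorem length_flatMap_replicate (α : Fin d → ℕ) :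
    ((List.finRange d).flatMap fun i => List.replicate (α i) i).length = msize α := by
  simp [msize, List.length_flatMap, Fin.sum_univ_def]

theorem count_flatMap_replicate (α : Fin d → ℕ) (j : Fin d) :
    ((List.finRange d).flatMap fun i => List.replicate (α i) i).count j = α j := by
  rw [List.count_flatMap, ← Fin.sum_univ_def]
  simp [List.count_replicate]

/-- The multi-index counting the occurrences of each direction. -/
def occ {n : ℕ} (s : Fin n → Fin d) : Fin d → ℕ := fun i => (List.ofFn s).count i

theorem perm_occ {n : ℕ} (s : Fin n → Fin d) :
    (List.ofFn s).Perm ((List.finRange d).flatMap fun i => List.replicate (occ s i) i) := by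
  rw [List.perm_iff_count]
  intro i
  rw [count_flatMap_replicate, occ]

theorem msize_occ {n : ℕ} (s : Fin n → Fin d) : msize (occ s) = n := by
  rw [← length_flatMap_replicate, ← (perm_occ s).length_eq, List.length_ofFn]

theorem mem_mIdx {m : ℕ} {α : Fin d → ℕ} : α ∈ mIdx d m ↔ msize α ≤ m := by
  simp only [mIdx, Finset.mem_filter, Fintype.mem_piFinset, Finset.mem_range, and_iff_right_iff_imp]
  intro h i
  exact Nat.lt_succ_of_le ((Finset.single_le_sum (f := α) (by simp) (Finset.mem_univ i)).trans h)

theorem mD_occ {n : ℕ} (s : Fin n → Fin d) {f : EuclideanSpace ℝ (Fin d) → F}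
    (hf : ContDiff ℝ n f) (x : EuclideanSpace ℝ (Fin d)) :
    mD (occ s) f x = iteratedFDeriv ℝ n f x (fun j => EuclideanSpace.single (s j) 1) := by
  rw [← pdList_ofFn s hf, mD, pdList_perm (perm_occ s) (by simpa using hf)]

theorem norm_mD_le (α : Fin d → ℕ) {f : EuclideanSpace ℝ (Fin d) → F}
    (hf : ContDiff ℝ (msize α) f) (x : EuclideanSpace ℝ (Fin d)) :
    ‖mD α f x‖ ≤ ‖iteratedFDeriv ℝ (msize α) f x‖ := by
  have h := norm_pdList_le ((List.finRange d).flatMap fun i => List.replicate (α i) i) (f := f)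
    (by rwa [length_flatMap_replicate]) x
  rwa [length_flatMap_replicate] at h

theorem norm_iteratedFDeriv_le_of_mD_le {n : ℕ} {f : EuclideanSpace ℝ (Fin d) → F}
    (hf : ContDiff ℝ n f) (x : EuclideanSpace ℝ (Fin d)) {B : ℝ}
    (hB : ∀ α : Fin d → ℕ, msize α = n → ‖mD α f x‖ ≤ B) :
    ‖iteratedFDeriv ℝ n f x‖ ≤ (d : ℝ) ^ n * B := by
  refine (norm_le_sum_norm_apply_single _).trans ?_
  refine (Finset.sum_le_card_nsmul _ _ B fun s _ => ?_).trans (by simp)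
  rw [← mD_occ s hf]
  exact hB _ (msize_occ s)

theorem continuous_mD (α : Fin d → ℕ) {f : EuclideanSpace ℝ (Fin d) → F}
    (hf : ContDiff ℝ (msize α) f) : Continuous (mD α f) :=
  (contDiff_pdList (n := 0) _ (by rwa [length_flatMap_replicate, zero_add])).continuous

theorem hasCompactSupport_pdList (l : List (Fin d)) {f : EuclideanSpace ℝ (Fin d) → F}
    (hf : HasCompactSupport f) : HasCompactSupport (pdList l f) := by
  induction l with
  | nil => exact hf
  | cons i l ih => exact ih.fderiv_apply ℝ _

end multiIndices

section japaneseBracket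

variable {d : ℕ}

theorem one_le_jb (x : EuclideanSpace ℝ (Fin d)) : 1 ≤ jb x :=
  Real.one_le_sqrt.2 (by nlinarith [sq_nonneg ‖x‖])

theorem jb_pos (x : EuclideanSpace ℝ (Fin d)) : 0 < jb x := zero_lt_one.trans_le (one_le_jb x)

theorem continuous_jb : Continuous (jb : EuclideanSpace ℝ (Fin d) → ℝ) := by
  unfold jb
  fun_prop

theorem jb_le_mul_jb {x y : EuclideanSpace ℝ (Fin d)} {K : ℝ} (hxy : ‖x - y‖ ≤ K) :
    jb x ≤ (1 + K) * jb y := by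
  have hK : 0 ≤ K := (norm_nonneg _).trans hxy
  have hx : ‖x‖ ≤ ‖y‖ + K := by
    have := norm_add_le y (x - y)
    rw [add_sub_cancel] at this
    linarith
  have hy := jb_pos y
  have hsq : jb y ^ 2 = 1 + ‖y‖ ^ 2 := Real.sq_sqrt (by positivity)
  refine Real.sqrt_le_iff.2 ⟨by positivity, ?_⟩
  rw [mul_pow, hsq]
  have : ‖x‖ ^ 2 ≤ (‖y‖ + K) ^ 2 := by gcongr
  nlinarith [sq_nonneg (‖y‖ - 1), mul_nonneg hK (sq_nonneg (‖y‖ - 1)), sq_nonneg (K * ‖y‖),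
    norm_nonneg y]

theorem jb_rpow_le_mul {x y : EuclideanSpace ℝ (Fin d)} {K : ℝ} (hxy : ‖x - y‖ ≤ K) {s S : ℝ}
    (hs : |s| ≤ S) : jb x ^ s ≤ (1 + K) ^ S * jb y ^ s := by
  have hK : 0 ≤ K := (norm_nonneg _).trans hxy
  have hx := jb_pos x
  have hy := jb_pos y
  have key : ∀ {a b : ℝ}, 0 < a → 0 < b → a ≤ (1 + K) * b → ∀ {t : ℝ}, 0 ≤ t → t ≤ S →
      a ^ t ≤ (1 + K) ^ S * b ^ t := by
    intro a b ha hb hab t ht htS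
    calc a ^ t ≤ ((1 + K) * b) ^ t := Real.rpow_le_rpow ha.le hab ht
      _ = (1 + K) ^ t * b ^ t := Real.mul_rpow (by positivity) hb.le
      _ ≤ (1 + K) ^ S * b ^ t := by
        gcongr
        linarith
  rcases le_total 0 s with h | h
  · exact key hx hy (jb_le_mul_jb hxy) h (by rwa [abs_of_nonneg h] at hs)
  · have := key (inv_pos.2 hx) (inv_pos.2 hy) (t := -s) ?_ (by linarith)
      (by rwa [abs_of_nonpos h] at hs)
    · simpa [Real.rpow_neg, Real.inv_rpow, hx.le, hy.le] using this
    · have := jb_le_mul_jb (x := y) (y := x) (K := K) (by rwa [norm_sub_rev])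
      rw [inv_le_iff_one_le_mul₀ hx, mul_right_comm, mul_comm _ (jb y)⁻¹, ← div_eq_inv_mul,
        le_div_iff₀ hy]
      linarith

end japaneseBracket

section composition

theorem norm_iteratedFDeriv_comp_le_of_scaled {E F G : Type*} [NormedAddCommGroup E]
    [NormedSpace ℝ E] [NormedAddCommGroup F] [NormedSpace ℝ F] [NormedAddCommGroup G]
    [NormedSpace ℝ G] {g : F → G} {φ : E → F} {n : ℕ} (hg : ContDiff ℝ n g) (hφ : ContDiff ℝ n φ)
    (x : E) {L M : ℝ} (hL : 0 < L)
    (hM : ∀ i, 1 ≤ i → i ≤ n → ‖iteratedFDeriv ℝ i φ x‖ ≤ L * (M / L) ^ i) :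
    ‖iteratedFDeriv ℝ n (fun z => g (φ z)) x‖ ≤
      n.factorial * (∑ i ∈ Finset.range (n + 1), L ^ i * ‖iteratedFDeriv ℝ i g (φ x)‖) *
        (M / L) ^ n := by
  have hcomp : (fun z => g (φ z)) = (fun z => g (L • z)) ∘ (L⁻¹ • φ) := by
    ext z
    simp [smul_smul, hL.ne']
  rw [hcomp]
  refine norm_iteratedFDeriv_comp_le (N := n) (hg.comp (contDiff_const_smul L))
    (hφ.const_smul L⁻¹) le_rfl x (fun i hi => ?_) (fun i h1 hi => ?_)
  · have hin : ((i : ℕ) : WithTop ℕ∞) ≤ n := by exact_mod_cast hi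
    change ‖iteratedFDeriv ℝ i (fun z => g (L • z)) (L⁻¹ • φ x)‖ ≤ _
    rw [iteratedFDeriv_comp_const_smul L (hg.of_le hin), norm_smul, norm_pow, Real.norm_eq_abs,
      abs_of_pos hL, smul_smul, mul_inv_cancel₀ hL.ne', one_smul]
    exact Finset.single_le_sum (f := fun i => L ^ i * ‖iteratedFDeriv ℝ i g (φ x)‖)
      (fun _ _ => by positivity) (Finset.mem_range.2 (Nat.lt_succ_of_le hi))
  · have hin : ((i : ℕ) : WithTop ℕ∞) ≤ n := by exact_mod_cast hi
    change ‖iteratedFDeriv ℝ i (L⁻¹ • φ) x‖ ≤ _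
    rw [iteratedFDeriv_const_smul_apply (hφ.of_le hin).contDiffAt, norm_smul, Real.norm_eq_abs,
      abs_of_pos (inv_pos.2 hL), inv_mul_le_iff₀ hL]
    exact hM i h1 hi

theorem norm_iteratedFDeriv_id_le {E : Type*} [NormedAddCommGroup E] [NormedSpace ℝ E] {i : ℕ}
    (hi : 1 ≤ i) (x : E) {L : ℝ} (hL : 0 < L) :
    ‖iteratedFDeriv ℝ i (fun z : E => z) x‖ ≤ L * (1 / L) ^ i := by
  obtain ⟨j, rfl⟩ := Nat.exists_eq_add_of_le' hi
  rw [← norm_iteratedFDeriv_fderiv]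
  have hfd : fderiv ℝ (fun z : E => z) = fun _ => ContinuousLinearMap.id ℝ E :=
    funext fun z => fderiv_fun_id
  rw [hfd]
  rcases Nat.eq_zero_or_pos j with rfl | hj
  · rw [norm_iteratedFDeriv_zero, zero_add, pow_one, mul_one_div_cancel hL.ne']
    exact ContinuousLinearMap.norm_id_le
  · rw [iteratedFDeriv_const_of_ne hj.ne']
    simp only [Pi.zero_apply, norm_zero]
    positivity

variable {d : ℕ}

theorem norm_iteratedFDeriv_add_displacement_le {m : ℕ} (hd : 1 ≤ d) {K : ℝ} (hK : 0 ≤ K)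
    {u : EuclideanSpace ℝ (Fin d) → EuclideanSpace ℝ (Fin d)} (hu : ContDiff ℝ m u)
    (hb : ∀ α ∈ mIdx d m, 1 ≤ msize α → ∀ x, ‖mD α u x‖ ≤ K * jb x ^ (1 - (msize α : ℝ)))
    {i : ℕ} (h1 : 1 ≤ i) (hi : i ≤ m) (x : EuclideanSpace ℝ (Fin d)) :
    ‖iteratedFDeriv ℝ i (fun z => z + u z) x‖ ≤
      jb x * ((1 + (d : ℝ) ^ m * K) / jb x) ^ i := by
  have hin : ((i : ℕ) : WithTop ℕ∞) ≤ m := by exact_mod_cast hi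
  have hx := jb_pos x
  have hd' : (1 : ℝ) ≤ d := by exact_mod_cast hd
  have hpow : jb x ^ (1 - (i : ℝ)) = jb x * (1 / jb x) ^ i := by
    rw [Real.rpow_sub hx, Real.rpow_one, Real.rpow_natCast, one_div, inv_pow, div_eq_mul_inv]
  have hui : ‖iteratedFDeriv ℝ i u x‖ ≤ (d : ℝ) ^ i * (K * (jb x * (1 / jb x) ^ i)) := by
    refine norm_iteratedFDeriv_le_of_mD_le (hu.of_le hin) x fun α hα => ?_
    have := hb α (mem_mIdx.2 (hα ▸ hi)) (hα ▸ h1) x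
    rwa [hα, hpow] at this
  have hadd := iteratedFDeriv_add_apply (𝕜 := ℝ) (i := i) (x := x)
    (f := fun z : EuclideanSpace ℝ (Fin d) => z) contDiff_id.contDiffAt (hu.of_le hin).contDiffAt
  change iteratedFDeriv ℝ i (fun z => z + u z) x = _ at hadd
  rw [hadd]
  have hdi : (d : ℝ) ^ i ≤ (d : ℝ) ^ m := pow_le_pow_right₀ hd' hi
  have hM : (1 : ℝ) ≤ 1 + (d : ℝ) ^ m * K := le_add_of_nonneg_right (by positivity)
  calc _ ≤ jb x * (1 / jb x) ^ i + (d : ℝ) ^ m * (K * (jb x * (1 / jb x) ^ i)) := by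
        refine (norm_add_le _ _).trans (add_le_add (norm_iteratedFDeriv_id_le h1 x hx)
          (hui.trans ?_))
        gcongr
    _ = (1 + (d : ℝ) ^ m * K) * (jb x * (1 / jb x) ^ i) := by ring
    _ ≤ (1 + (d : ℝ) ^ m * K) ^ i * (jb x * (1 / jb x) ^ i) := by
        gcongr
        exact le_self_pow₀ hM (by omega)
    _ = _ := by rw [div_pow, div_pow, one_pow]; ring

/-- The constant in the pointwise estimate for weighted derivatives of `f ∘ (Id + u)`. -/
def pointwiseConst (d m : ℕ) (δ K : ℝ) : ℝ :=
  m.factorial * (1 + (d : ℝ) ^ m * K) ^ m *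
    ((1 + K) ^ (|δ| + m) * ∑ i ∈ Finset.range (m + 1), (d : ℝ) ^ i)

theorem pointwiseConst_nonneg (d m : ℕ) (δ : ℝ) {K : ℝ} (hK : 0 ≤ K) :
    0 ≤ pointwiseConst d m δ K := by
  unfold pointwiseConst
  positivity

theorem weighted_mD_comp_le {m : ℕ} (hd : 1 ≤ d) (δ : ℝ) {K : ℝ} (hK : 0 ≤ K)
    {u : EuclideanSpace ℝ (Fin d) → EuclideanSpace ℝ (Fin d)} (hu : ContDiff ℝ m u)
    (hK' : ∀ x, ‖u x‖ ≤ K)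
    (hb : ∀ α ∈ mIdx d m, 1 ≤ msize α → ∀ x, ‖mD α u x‖ ≤ K * jb x ^ (1 - (msize α : ℝ)))
    {f : EuclideanSpace ℝ (Fin d) → ℝ} (hf : ContDiff ℝ m f) {k : ℕ} (hk : k ≤ m)
    {α : Fin d → ℕ} (hα : α ∈ mIdx d k) (x : EuclideanSpace ℝ (Fin d)) :
    jb x ^ (δ + (msize α : ℝ)) * |mD α (fun y => f (y + u y)) x| ≤
      pointwiseConst d m δ K *
        ∑ β ∈ mIdx d k, jb (x + u x) ^ (δ + (msize β : ℝ)) * |mD β f (x + u x)| := by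
  set S := ∑ β ∈ mIdx d k, jb (x + u x) ^ (δ + (msize β : ℝ)) * |mD β f (x + u x)| with hS
  have hpos : ∀ β : Fin d → ℕ,
      0 ≤ jb (x + u x) ^ (δ + (msize β : ℝ)) * |mD β f (x + u x)| := fun β =>
    mul_nonneg (Real.rpow_nonneg (jb_pos _).le _) (abs_nonneg _)
  have hS0 : 0 ≤ S := Finset.sum_nonneg fun β _ => hpos β
  have hx := jb_pos x
  have hy := jb_pos (x + u x)
  set n := msize α with hn
  have hnk : n ≤ k := mem_mIdx.1 hα
  have hnm : ((n : ℕ) : WithTop ℕ∞) ≤ m := by exact_mod_cast hnk.trans hk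
  have hφ : ContDiff ℝ m (fun z => z + u z) := contDiff_id.add hu
  set M := 1 + (d : ℝ) ^ m * K with hMdef
  have hM : (1 : ℝ) ≤ M := le_add_of_nonneg_right (by positivity)
  have hterm : ∀ i ≤ n, jb x ^ (δ + (i : ℝ)) * ‖iteratedFDeriv ℝ i f (x + u x)‖ ≤
      (1 + K) ^ (|δ| + m) * (d : ℝ) ^ i * S := by
    intro i hi
    have him : i ≤ m := hi.trans (hnk.trans hk)
    have hyi : 0 < jb (x + u x) ^ (δ + (i : ℝ)) := Real.rpow_pos_of_pos hy _
    have h1 : jb x ^ (δ + (i : ℝ)) ≤ (1 + K) ^ (|δ| + m) * jb (x + u x) ^ (δ + (i : ℝ)) := by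
      refine jb_rpow_le_mul (by simpa using hK' x) ((abs_add_le _ _).trans ?_)
      rw [Nat.abs_cast]
      gcongr
    have h2 : ‖iteratedFDeriv ℝ i f (x + u x)‖ ≤
        (d : ℝ) ^ i * (S / jb (x + u x) ^ (δ + (i : ℝ))) := by
      refine norm_iteratedFDeriv_le_of_mD_le (hf.of_le (by exact_mod_cast him)) _ fun β hβ => ?_
      rw [le_div_iff₀' hyi, ← hβ]
      exact Finset.single_le_sum (fun β _ => hpos β) (mem_mIdx.2 (hβ ▸ hi.trans hnk))
    calc _ ≤ ((1 + K) ^ (|δ| + m) * jb (x + u x) ^ (δ + (i : ℝ))) *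
          ((d : ℝ) ^ i * (S / jb (x + u x) ^ (δ + (i : ℝ)))) := by gcongr
      _ = _ := by field_simp
  have hmain := norm_iteratedFDeriv_comp_le_of_scaled (hf.of_le hnm) (hφ.of_le hnm) x hx
    (M := M) fun i h1 hi => norm_iteratedFDeriv_add_displacement_le hd hK hu hb h1
      (hi.trans (hnk.trans hk)) x
  have hmD := (norm_mD_le α ((hf.comp hφ).of_le hnm) x).trans hmain
  rw [Real.norm_eq_abs] at hmD
  calc _ ≤ jb x ^ (δ + (n : ℝ)) * (n.factorial * (∑ i ∈ Finset.range (n + 1),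
          jb x ^ i * ‖iteratedFDeriv ℝ i f (x + u x)‖) * (M / jb x) ^ n) := by
        gcongr
        exact hmD
    _ = n.factorial * M ^ n * ∑ i ∈ Finset.range (n + 1),
          jb x ^ (δ + (i : ℝ)) * ‖iteratedFDeriv ℝ i f (x + u x)‖ := by
        simp only [Real.rpow_add hx, Real.rpow_natCast, mul_assoc, ← Finset.mul_sum]
        rw [div_pow]
        field_simp
    _ ≤ n.factorial * M ^ n * ∑ i ∈ Finset.range (n + 1),
          (1 + K) ^ (|δ| + m) * (d : ℝ) ^ i * S := by
        refine mul_le_mul_of_nonneg_left (Finset.sum_le_sum fun i hi => ?_) (by positivity)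
        exact hterm i (Nat.lt_succ_iff.1 (Finset.mem_range.1 hi))
    _ = n.factorial * M ^ n *
          ((1 + K) ^ (|δ| + m) * ∑ i ∈ Finset.range (n + 1), (d : ℝ) ^ i) * S := by
        rw [← Finset.sum_mul, ← Finset.mul_sum]
        ring
    _ ≤ _ := by
        unfold pointwiseConst
        have hnm' := hnk.trans hk
        gcongr

theorem integral_rpow_comp_le {E ι : Type*} [NormedAddCommGroup E] [NormedSpace ℝ E]
    [FiniteDimensional ℝ E] [MeasurableSpace E] [BorelSpace E] (μ : Measure E)
    [μ.IsAddHaarMeasure] {φ : E → E} (hφ : Differentiable ℝ φ) (hbij : Function.Bijective φ)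
    {ε : ℝ} (hε : 0 < ε) (hdet : ∀ x, ε ≤ (fderiv ℝ φ x).det) {p : ℝ} (hp : 1 ≤ p)
    {I : Finset ι} {b : ι → E → ℝ} (hb0 : ∀ i x, 0 ≤ b i x)
    (hb : ∀ i ∈ I, Integrable (fun x => b i x ^ p) μ) {a : E → ℝ} (ha0 : ∀ x, 0 ≤ a x) {C : ℝ}
    (hC : 0 ≤ C) (ha : ∀ x, a x ≤ C * ∑ i ∈ I, b i (φ x)) :
    (∫ x, a x ^ p ∂μ) ^ (1 / p) ≤
      C * I.card * (ε⁻¹) ^ (1 / p) * ∑ i ∈ I, (∫ x, b i x ^ p ∂μ) ^ (1 / p) := by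
  have hp0 : 0 < p := by linarith
  have hbp : ∀ i x, 0 ≤ b i x ^ p := fun i x => Real.rpow_nonneg (hb0 i x) p
  have hint : ∀ i, 0 ≤ ∫ x, b i x ^ p ∂μ := fun i => integral_nonneg (hbp i)
  set S := ∑ i ∈ I, (∫ x, b i x ^ p ∂μ) ^ (1 / p) with hS
  have hS0 : 0 ≤ S := Finset.sum_nonneg fun i _ => Real.rpow_nonneg (hint i) _
  set g : E → ℝ := fun x => C ^ p * ((I.card : ℝ) ^ (p - 1) * ∑ i ∈ I, b i x ^ p) with hg
  have hg0 : ∀ x, 0 ≤ g x := fun x => by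
    have := Finset.sum_nonneg fun i (_ : i ∈ I) => hbp i x
    positivity
  have hgint : Integrable g μ := ((integrable_finsetSum I hb).const_mul _).const_mul _
  have hder : ∀ x ∈ Set.univ, HasFDerivWithinAt φ (fderiv ℝ φ x) Set.univ x := fun x _ =>
    (hφ x).hasFDerivAt.hasFDerivWithinAt
  have hcov := integral_image_eq_integral_abs_det_fderiv_smul μ MeasurableSet.univ hder
    hbij.1.injOn g
  have hcovint := integrableOn_image_iff_integrableOn_abs_det_fderiv_smul μ MeasurableSet.univ hder
    hbij.1.injOn g
  rw [Set.image_univ, hbij.2.range_eq, integrableOn_univ, integrableOn_univ] at hcovint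
  rw [Set.image_univ, hbij.2.range_eq, setIntegral_univ, setIntegral_univ] at hcov
  have hle : ∀ x, a x ^ p ≤ ε⁻¹ * (|(fderiv ℝ φ x).det| • g (φ x)) := by
    intro x
    have h1 : a x ^ p ≤ g (φ x) := by
      calc a x ^ p ≤ (C * ∑ i ∈ I, b i (φ x)) ^ p := Real.rpow_le_rpow (ha0 x) (ha x) hp0.le
        _ = C ^ p * (∑ i ∈ I, b i (φ x)) ^ p :=
            Real.mul_rpow hC (Finset.sum_nonneg fun i _ => hb0 i _)
        _ ≤ g (φ x) := by
            have := Real.rpow_sum_le_const_mul_sum_rpow I (fun i => b i (φ x)) hp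
            simp only [abs_of_nonneg (hb0 _ _)] at this
            exact mul_le_mul_of_nonneg_left this (Real.rpow_nonneg hC p)
    have h2 : ε * g (φ x) ≤ |(fderiv ℝ φ x).det| * g (φ x) :=
      mul_le_mul_of_nonneg_right ((hdet x).trans (le_abs_self _)) (hg0 _)
    rw [smul_eq_mul, ← div_eq_inv_mul, le_div_iff₀' hε]
    exact (mul_le_mul_of_nonneg_left h1 hε.le).trans h2
  have hterm : ∀ i ∈ I, ∫ x, b i x ^ p ∂μ ≤ S ^ p := by
    intro i hi
    have h1 : (∫ x, b i x ^ p ∂μ) ^ (1 / p) ≤ S :=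
      Finset.single_le_sum (f := fun i => (∫ x, b i x ^ p ∂μ) ^ (1 / p))
        (fun i _ => Real.rpow_nonneg (hint i) _) hi
    have h2 := Real.rpow_le_rpow (Real.rpow_nonneg (hint i) _) h1 hp0.le
    rwa [← Real.rpow_mul (hint i), one_div_mul_cancel hp0.ne', Real.rpow_one] at h2
  have hbound : ∫ x, a x ^ p ∂μ ≤ (C * I.card * (ε⁻¹) ^ (1 / p) * S) ^ p := by
    calc ∫ x, a x ^ p ∂μ ≤ ∫ x, ε⁻¹ * (|(fderiv ℝ φ x).det| • g (φ x)) ∂μ :=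
          integral_mono_of_nonneg (.of_forall fun x => Real.rpow_nonneg (ha0 x) p)
            ((hcovint.1 hgint).const_mul _) (.of_forall hle)
      _ = ε⁻¹ * (C ^ p * ((I.card : ℝ) ^ (p - 1) * ∑ i ∈ I, ∫ x, b i x ^ p ∂μ)) := by
          rw [integral_const_mul, ← hcov, hg, integral_const_mul, integral_const_mul,
            integral_finsetSum I hb]
      _ ≤ ε⁻¹ * (C ^ p * ((I.card : ℝ) ^ (p - 1) * (I.card * S ^ p))) := by
          gcongr
          exact (Finset.sum_le_card_nsmul I _ _ hterm).trans (by simp)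
      _ = (C * I.card * (ε⁻¹) ^ (1 / p) * S) ^ p := by
          have hcard : (I.card : ℝ) ^ (p - 1) * I.card = (I.card : ℝ) ^ p := by
            rw [← Real.rpow_add_one' (by positivity) (by linarith), sub_add_cancel]
          rw [Real.mul_rpow (by positivity) hS0, Real.mul_rpow (by positivity) (by positivity),
            Real.mul_rpow hC (by positivity), ← Real.rpow_mul (by positivity),
            one_div_mul_cancel hp0.ne', Real.rpow_one, ← hcard]
          ring
  rw [one_div]
  rw [one_div] at hbound
  exact (Real.rpow_inv_le_iff_of_pos (integral_nonneg fun x => Real.rpow_nonneg (ha0 x) p)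
    (mul_nonneg (by positivity) (by simpa using hS0)) hp0).2 (by simpa using hbound)

theorem integrable_weighted_mD {d : ℕ} {p : ℝ} (hp : 0 < p) (δ : ℝ) (α : Fin d → ℕ)
    {f : EuclideanSpace ℝ (Fin d) → ℝ} (hf : ContDiff ℝ (msize α) f) (hfc : HasCompactSupport f) :
    Integrable fun x => (jb x ^ (δ + (msize α : ℝ)) * |mD α f x|) ^ p := by
  have hcont : Continuous fun x : EuclideanSpace ℝ (Fin d) =>
      (jb x ^ (δ + (msize α : ℝ)) * |mD α f x|) ^ p :=
    ((continuous_jb.rpow_const fun x => Or.inl (jb_pos x).ne').mul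
      (continuous_mD α hf).abs).rpow_const fun _ => Or.inr hp.le
  refine hcont.integrable_of_hasCompactSupport ?_
  have hmD : HasCompactSupport (mD α f) := hasCompactSupport_pdList _ hfc
  refine hmD.mono fun x hx h0 => hx ?_
  simp [h0, hp.ne']

end composition

/-- Boundedness of composition with an asymptotic-type diffeomorphism
`φ = Id + u` on the weighted Sobolev spaces `W^{k,p}_δ(ℝ^d)`, `0 ≤ k ≤ m`:
`‖f ∘ φ‖_{W^{k,p}_δ} ≤ C ‖f‖_{W^{k,p}_δ}` for `f ∈ C_c^∞(ℝ^d)`, with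
`C = C(d,m,p,δ,K,ε)`. -/
theorem composition_bound_W
    (d m : ℕ) (hd : 1 ≤ d) (p δ K ε : ℝ) (hp : 1 < p)
    (hm : 1 + (d : ℝ) / p < (m : ℝ)) (hK : 1 ≤ K) (hε : 0 < ε) :
    ∃ C : ℝ, 0 < C ∧
      ∀ u : EuclideanSpace ℝ (Fin d) → EuclideanSpace ℝ (Fin d),
        ContDiff ℝ m (fun x => x + u x) →
        Function.Bijective (fun x => x + u x) →
        ContDiff ℝ m (Function.invFun (fun x => x + u x)) →
        (∀ x, ‖u x‖ ≤ K) →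
        (∀ α ∈ mIdx d m, 1 ≤ msize α →
          ∀ x, ‖mD α u x‖ ≤ K * jb x ^ (1 - (msize α : ℝ))) →
        (∀ x, ε ≤ (fderiv ℝ (fun x => x + u x) x).det) →
        ∀ f : EuclideanSpace ℝ (Fin d) → ℝ, ContDiff ℝ (⊤ : ℕ∞) f → HasCompactSupport f →
        ∀ k : ℕ, k ≤ m →
          ∑ α ∈ mIdx d k,
              (∫ x, (jb x ^ (δ + (msize α : ℝ)) * |mD α (fun y => f (y + u y)) x|) ^ p) ^ (1 / p) ≤
            C * ∑ α ∈ mIdx d k,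
              (∫ x, (jb x ^ (δ + (msize α : ℝ)) * |mD α f x|) ^ p) ^ (1 / p) := by
  
  have hK0 : 0 ≤ K := zero_le_one.trans hK
  have hp0 : 0 < p := zero_lt_one.trans hp
  have hm1 : m ≠ 0 := by
    rintro rfl
    have : (0 : ℝ) ≤ d / p := by positivity
    simp only [Nat.cast_zero] at hm
    linarith
  have hC1 := pointwiseConst_nonneg d m δ hK0
  set N : ℝ := ((mIdx d m).card : ℝ) with hN
  set C₁ := pointwiseConst d m δ K * N * (ε⁻¹) ^ (1 / p) with hC₁
  have hC₁0 : 0 ≤ C₁ := by positivity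
  refine ⟨N * C₁ + 1, by positivity, ?_⟩
  intro u hφ hbij _ hu hb hdet f hf hfc k hk
  have hu' : ContDiff ℝ m u := by
    have h := hφ.sub contDiff_id
    simpa using h
  have hfm : ContDiff ℝ m f := hf.of_le (by exact_mod_cast le_top)
  have hcard : ((mIdx d k).card : ℝ) ≤ N := by
    rw [hN]
    exact_mod_cast Finset.card_le_card fun α hα => mem_mIdx.2 ((mem_mIdx.1 hα).trans hk)
  set S := ∑ α ∈ mIdx d k,
    (∫ x, (jb x ^ (δ + (msize α : ℝ)) * |mD α f x|) ^ p) ^ (1 / p) with hS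
  have hnn : ∀ (g : EuclideanSpace ℝ (Fin d) → ℝ) (α : Fin d → ℕ) (x : EuclideanSpace ℝ (Fin d)),
      0 ≤ jb x ^ (δ + (msize α : ℝ)) * |mD α g x| := fun g α x =>
    mul_nonneg (Real.rpow_nonneg (jb_pos x).le _) (abs_nonneg _)
  have hS0 : 0 ≤ S := Finset.sum_nonneg fun α _ =>
    Real.rpow_nonneg (integral_nonneg fun x => Real.rpow_nonneg (hnn f α x) _) _
  have hterm : ∀ α ∈ mIdx d k,
      (∫ x, (jb x ^ (δ + (msize α : ℝ)) * |mD α (fun y => f (y + u y)) x|) ^ p) ^ (1 / p) ≤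
        C₁ * S := by
    intro α hα
    refine (integral_rpow_comp_le volume (hφ.differentiable (by exact_mod_cast hm1)) hbij hε hdet
      hp.le (hnn f) (fun β hβ => integrable_weighted_mD hp0 δ β
        (hf.of_le (by exact_mod_cast le_top)) hfc) (hnn _ α) hC1
      (weighted_mD_comp_le hd δ hK0 hu' hu hb hfm hk hα)).trans ?_
    rw [hC₁]
    gcongr
  calc _ ≤ ((mIdx d k).card : ℝ) * (C₁ * S) :=
        (Finset.sum_le_card_nsmul _ _ _ hterm).trans (by simp)
    _ ≤ N * (C₁ * S) := by gcongr
    _ ≤ (N * C₁ + 1) * S := by linarith
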